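/- arXiv:2511.09365 — 2 statements merged into one kernel-verified Lean document; each statement's English description precedes it below -/
import Mathlib

section
/- There is a constant r₀ such that the following holds: for every integer r ≥ r₀, every integer N ≥ exp(exp(r^50)), and every colouring c : {1,…,N} → {1,…,r}, there exist integers x, y with x > y > 2, x+y ≤ N and x·y ≤ N such that c(x+y) = c(x·y). -/
open scoped RealInnerProductSpace

section Flow

variable {H : Type*} [NormedAddCommGroup H] [InnerProductSpace ℝ H]

/-- An action of `ℤ` on a real inner product space by linear isometries. -/
structure IsFlow (S : ℤ → H →ₗᵢ[ℝ] H) : Prop where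
  zero : ∀ x, S 0 x = x
  add : ∀ a b x, S (a + b) x = S a (S b x)

/-- The sum of the translates of a vector along `τ, 2τ, …, Vτ`. -/
noncomputable def progSum (S : ℤ → H →ₗᵢ[ℝ] H) (τ : ℤ) (V : ℕ) : H →ₗ[ℝ] H :=
  ∑ v ∈ Finset.Icc 1 V, (S (τ * v)).toLinearMap

/-- The Fejér average of the translates of a vector along multiples of `ρ`. -/
noncomputable def fejer (S : ℤ → H →ₗᵢ[ℝ] H) (ρ : ℤ) (l : ℕ) : H →ₗ[ℝ] H :=
  ((l : ℝ) ^ 2)⁻¹ • ∑ h ∈ Finset.range l, ∑ k ∈ Finset.range l,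
    (S (ρ * ((h : ℤ) - k))).toLinearMap

variable {S : ℤ → H →ₗᵢ[ℝ] H}

theorem progSum_apply (τ : ℤ) (V : ℕ) (x : H) :
    progSum S τ V x = ∑ v ∈ Finset.Icc 1 V, S (τ * v) x := by
  simp [progSum, LinearMap.sum_apply]

theorem fejer_apply (ρ : ℤ) (l : ℕ) (x : H) :
    fejer S ρ l x = ((l : ℝ) ^ 2)⁻¹ • ∑ h ∈ Finset.range l, ∑ k ∈ Finset.range l,
      S (ρ * ((h : ℤ) - k)) x := by
  simp [fejer, LinearMap.sum_apply]

theorem norm_progSum_le (τ : ℤ) (V : ℕ) (x : H) : ‖progSum S τ V x‖ ≤ V * ‖x‖ := by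
  rw [progSum_apply]
  refine (norm_sum_le _ _).trans ?_
  simp

theorem norm_fejer_le (ρ : ℤ) {l : ℕ} (hl : 0 < l) (x : H) : ‖fejer S ρ l x‖ ≤ ‖x‖ := by
  have hl' : (0 : ℝ) < l := by exact_mod_cast hl
  rw [fejer_apply, norm_smul, Real.norm_of_nonneg (by positivity), inv_mul_le_iff₀ (by positivity)]
  refine (norm_sum_le _ _).trans ((Finset.sum_le_sum fun h _ => norm_sum_le _ _).trans ?_)
  simp only [LinearIsometry.norm_map, Finset.sum_const, Finset.card_range, nsmul_eq_mul]
  exact le_of_eq (by ring)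

theorem norm_sub_fejer_le (ρ : ℤ) {l : ℕ} (hl : 0 < l) (x : H) :
    ‖x - fejer S ρ l x‖ ≤ 2 * ‖x‖ := by
  linarith [norm_sub_le x (fejer S ρ l x), norm_fejer_le (S := S) ρ hl x]

/-- Subtracting the Fejér average is averaging the differences with translates. -/
theorem sub_fejer_eq (ρ : ℤ) {l : ℕ} (hl : 0 < l) (x : H) :
    x - fejer S ρ l x = ((l : ℝ) ^ 2)⁻¹ • ∑ h ∈ Finset.range l, ∑ k ∈ Finset.range l,
      (x - S (ρ * ((h : ℤ) - k)) x) := by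
  have hl' : (l : ℝ) ≠ 0 := by exact_mod_cast hl.ne'
  simp only [Finset.sum_sub_distrib, Finset.sum_const, Finset.card_range, smul_sub, fejer_apply,
    ← Nat.cast_smul_eq_nsmul ℝ, smul_smul]
  congr 1
  rw [show ((l : ℝ) ^ 2)⁻¹ * (l * l) = 1 by field_simp, one_smul]

namespace IsFlow

variable (hS : IsFlow S)
include hS

theorem comm (a b : ℤ) (x : H) : S a (S b x) = S b (S a x) := by
  rw [← hS.add, ← hS.add, add_comm]

theorem inner_left (a : ℤ) (x y : H) : ⟪S a x, y⟫ = ⟪x, S (-a) y⟫ := by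
  rw [← (S (-a)).inner_map_map, ← hS.add, neg_add_cancel, hS.zero]

theorem progSum_shift (τ a : ℤ) (V : ℕ) (x : H) :
    progSum S τ V (S a x) = S a (progSum S τ V x) := by
  simp only [progSum_apply, map_sum, hS.comm]

theorem fejer_shift (ρ a : ℤ) (l : ℕ) (x : H) :
    fejer S ρ l (S a x) = S a (fejer S ρ l x) := by
  simp only [fejer_apply, map_sum, map_smul]
  congr 1
  exact Finset.sum_congr rfl fun h _ => Finset.sum_congr rfl fun k _ => hS.comm _ _ _

theorem fejer_progSum (ρ τ : ℤ) (l V : ℕ) (x : H) :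
    fejer S ρ l (progSum S τ V x) = progSum S τ V (fejer S ρ l x) := by
  simp only [progSum_apply, map_sum, hS.fejer_shift]

theorem inner_fejer (ρ : ℤ) (l : ℕ) (x y : H) :
    ⟪fejer S ρ l x, y⟫ = ⟪x, fejer S ρ l y⟫ := by
  simp only [fejer_apply, inner_smul_left, inner_smul_right, sum_inner, inner_sum,
    hS.inner_left]
  rw [Finset.sum_comm]
  simp only [← mul_neg, neg_sub]
  simp

theorem progSum_sub_shift (τ : ℤ) (V : ℕ) (x : H) :
    progSum S τ V (x - S τ x) = S τ x - S (τ * (V + 1)) x := by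
  rw [progSum_apply]
  induction V with
  | zero => simp
  | succ V ih =>
    rw [Finset.sum_Icc_succ_top (by omega), ih, map_sub, ← hS.add]
    push_cast
    rw [show τ * ((V : ℤ) + 1) + τ = τ * (V + 1 + 1) by ring]
    abel

theorem norm_progSum_sub_shift_nat_le (τ : ℤ) (V n : ℕ) (x : H) :
    ‖progSum S τ V (x - S (τ * n) x)‖ ≤ 2 * n * ‖x‖ := by
  induction n with
  | zero => simp [hS.zero]
  | succ n ih =>
    have h : x - S (τ * (n + 1 : ℕ)) x
        = (x - S (τ * n) x) + (S (τ * n) x - S τ (S (τ * n) x)) := by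
      rw [← hS.add, show τ + τ * (n : ℤ) = τ * (n + 1 : ℕ) by push_cast; ring]
      abel
    rw [h, map_add, hS.progSum_sub_shift]
    refine (norm_add_le _ _).trans ?_
    have := norm_sub_le (S τ (S (τ * n) x)) (S (τ * (V + 1)) (S (τ * n) x))
    simp only [LinearIsometry.norm_map] at this
    push_cast
    linarith

/-- Sums along a progression of difference `τ` are almost invariant under multiples of `τ`. -/
theorem norm_progSum_sub_shift_le (τ : ℤ) (V : ℕ) (a : ℤ) (x : H) :
    ‖progSum S τ V (x - S (τ * a) x)‖ ≤ 2 * |(a : ℝ)| * ‖x‖ := by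
  obtain ⟨n, rfl | rfl⟩ := a.eq_nat_or_neg
  · simpa using hS.norm_progSum_sub_shift_nat_le τ V n x
  · have h : x - S (τ * -n) x = -(S (τ * -n) x - S (τ * n) (S (τ * -n) x)) := by
      rw [← hS.add, ← mul_add, add_neg_cancel, mul_zero, hS.zero, neg_sub]
    rw [h, map_neg, norm_neg]
    simpa using hS.norm_progSum_sub_shift_nat_le τ V n (S (τ * -n) x)

end IsFlow

theorem exists_bezout_of_coprime {s t : ℕ} (ht : 0 < t) (hst : Nat.Coprime s t) (d : ℤ) :
    ∃ a b : ℤ, d = a * s - b * t ∧ |a| ≤ t ∧ |b| * t ≤ s * t + |d| := by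
  obtain ⟨u, w, huw⟩ := Nat.isCoprime_iff_coprime.mpr hst
  have ht' : (0 : ℤ) < t := by exact_mod_cast ht
  have h0 := Int.emod_nonneg (d * u) ht'.ne'
  have h1 := Int.emod_lt_of_pos (d * u) ht'
  have h2 := Int.emod_add_mul_ediv (d * u) t
  have key : d = (d * u % t) * s - (-(d * w) - (d * u / t) * s) * t := by
    linear_combination (-d) * huw + (s : ℤ) * (-h2)
  refine ⟨d * u % t, -(d * w) - (d * u / t) * s, key, ?_, ?_⟩
  · rw [abs_of_nonneg h0]; exact h1.le
  · generalize -(d * w) - (d * u / t) * s = b at key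
    generalize d * u % t = a at *
    have h3 : |b| * t = |b * t| := by rw [abs_mul, abs_of_pos ht']
    rw [h3, show b * (t : ℤ) = a * s - d by linarith]
    have h4 : |a * (s : ℤ)| ≤ s * t := by
      rw [abs_of_nonneg (by positivity), mul_comm]
      exact mul_le_mul_of_nonneg_left h1.le (by positivity)
    linarith [abs_sub (a * (s : ℤ)) d]

namespace IsFlow

variable (hS : IsFlow S)
include hS

/-- Sums along progressions of coprime differences `ρs` and `ρt` are almost orthogonal
on differences with translates by multiples of `ρ`. -/
theorem inner_progSum_sub_shift_le {ρ d : ℤ} {s t V : ℕ} {η : ℝ} (ht : 0 < t)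
    (hst : Nat.Coprime s t) (hη : 2 * ((s : ℝ) + t + |(d : ℝ)| / t) ≤ η * V) (x y : H) :
    ⟪progSum S (ρ * s) V (x - S (ρ * d) x), progSum S (ρ * t) V y⟫
      ≤ η * V ^ 2 * (‖x‖ * ‖y‖) := by
  obtain ⟨a, b, hd, ha, hb⟩ := exists_bezout_of_coprime ht hst d
  have ht' : (0 : ℝ) < t := by exact_mod_cast ht
  have ha' : |(a : ℝ)| ≤ t := by exact_mod_cast ha
  have hb' : |(b : ℝ)| ≤ s + |(d : ℝ)| / t := by
    have : |(b : ℝ)| * t ≤ s * t + |(d : ℝ)| := by exact_mod_cast hb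
    rw [← sub_nonneg] at this ⊢
    have h2 : (s : ℝ) + |(d : ℝ)| / t - |(b : ℝ)| = (s * t + |(d : ℝ)| - |(b : ℝ)| * t) / t := by
      field_simp
    rw [h2]; positivity
  have hsplit : x - S (ρ * d) x = (x - S (ρ * s * a) x)
      + (S (ρ * s * a) x - S (ρ * t * (-b)) (S (ρ * s * a) x)) := by
    rw [← hS.add, show ρ * t * (-b) + ρ * s * a = ρ * d by rw [hd]; ring]
    abel
  set x' := S (ρ * s * a) x with hx'
  have hx'n : ‖x'‖ = ‖x‖ := by simp [hx']
  clear_value x'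
  have h1 : ⟪progSum S (ρ * s) V (x - x'), progSum S (ρ * t) V y⟫
      ≤ (2 * t * ‖x‖) * (V * ‖y‖) := by
    refine (real_inner_le_norm _ _).trans ?_
    refine mul_le_mul ?_ (norm_progSum_le _ _ _) (norm_nonneg _) (by positivity)
    rw [hx']
    refine (hS.norm_progSum_sub_shift_le (ρ * s) V a x).trans ?_
    gcongr
  have h2 : ⟪progSum S (ρ * s) V (x' - S (ρ * t * (-b)) x'), progSum S (ρ * t) V y⟫
      ≤ (V * ‖x‖) * (2 * (s + |(d : ℝ)| / t) * ‖y‖) := by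
    have h3 : ⟪progSum S (ρ * s) V (x' - S (ρ * t * (-b)) x'), progSum S (ρ * t) V y⟫
        = ⟪progSum S (ρ * s) V x', progSum S (ρ * t) V (y - S (ρ * t * b) y)⟫ := by
      rw [map_sub, hS.progSum_shift, inner_sub_left, hS.inner_left, map_sub, inner_sub_right,
        hS.progSum_shift, show -(ρ * t * -b) = ρ * t * b by ring]
    rw [h3]
    refine (real_inner_le_norm _ _).trans ?_
    refine mul_le_mul ((norm_progSum_le _ _ _).trans (by rw [hx'n]))
      ((hS.norm_progSum_sub_shift_le (ρ * t) V b y).trans ?_) (norm_nonneg _) (by positivity)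
    gcongr
  rw [hsplit, map_add, inner_add_left]
  have h4 : 2 * ((s : ℝ) + t + |(d : ℝ)| / t) * (V * (‖x‖ * ‖y‖)) ≤
      η * V * (V * (‖x‖ * ‖y‖)) := by gcongr
  linarith

theorem inner_progSum_sub_fejer_le {ρ : ℤ} {l s t V : ℕ} {η : ℝ} (hl : 0 < l) (ht : 0 < t)
    (hst : Nat.Coprime s t) (hη : 2 * ((s : ℝ) + t + (l : ℝ) / t) ≤ η * V) (x y : H) :
    ⟪progSum S (ρ * s) V (x - fejer S ρ l x), progSum S (ρ * t) V y⟫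
      ≤ η * V ^ 2 * (‖x‖ * ‖y‖) := by
  have hl' : (0 : ℝ) < l := by exact_mod_cast hl
  rw [sub_fejer_eq ρ hl]
  simp only [map_smul, map_sum, inner_smul_left, sum_inner]
  rw [RCLike.conj_to_real, inv_mul_le_iff₀ (by positivity)]
  calc _ ≤ ∑ h ∈ Finset.range l, ∑ k ∈ Finset.range l, η * V ^ 2 * (‖x‖ * ‖y‖) := by
        refine Finset.sum_le_sum fun h hh => Finset.sum_le_sum fun k hk => ?_
        refine hS.inner_progSum_sub_shift_le ht hst (le_trans ?_ hη) x y
        rw [Finset.mem_range] at hh hk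
        have : |(((h : ℤ) - k : ℤ) : ℝ)| ≤ l := by
          have : |(h : ℤ) - k| ≤ l := by rw [abs_le]; omega
          exact_mod_cast this
        gcongr
    _ = _ := by simp; ring

end IsFlow

namespace IsFlow

variable (hS : IsFlow S)
include hS

theorem fejer_eq_sum_progSum (ρ : ℤ) (l : ℕ) (x : H) :
    fejer S ρ l x
      = ((l : ℝ) ^ 2)⁻¹ • ∑ k ∈ Finset.Icc 1 l, S (ρ * -k) (progSum S ρ l x) := by
  have hr : ∀ f : ℕ → H, ∑ k ∈ Finset.Icc 1 l, f k = ∑ k ∈ Finset.range l, f (k + 1) := by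
    intro f
    rw [Finset.range_eq_Ico, Finset.sum_Ico_add' f 0 l 1]
    rfl
  rw [fejer_apply, progSum_apply, Finset.sum_comm]
  simp only [map_sum, ← hS.add, hr]
  congr 1
  refine Finset.sum_congr rfl fun k _ => Finset.sum_congr rfl fun h _ => ?_
  congr 2
  push_cast
  ring

/-- Fejér averages are almost invariant under short translates. -/
theorem norm_fejer_sub_shift_le (ρ : ℤ) {l : ℕ} (hl : 0 < l) (v : ℕ) (x : H) :
    ‖fejer S ρ l x - S (ρ * v) (fejer S ρ l x)‖ ≤ 2 * v / l * ‖x‖ := by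
  have hl' : (0 : ℝ) < l := by exact_mod_cast hl
  rw [← hS.fejer_shift, ← map_sub, hS.fejer_eq_sum_progSum, norm_smul,
    Real.norm_of_nonneg (by positivity), inv_mul_le_iff₀ (by positivity)]
  refine (norm_sum_le _ _).trans ?_
  simp only [LinearIsometry.norm_map, Finset.sum_const, Nat.card_Icc, add_tsub_cancel_right,
    nsmul_eq_mul]
  have := hS.norm_progSum_sub_shift_nat_le ρ l v x
  calc (l : ℝ) * ‖progSum S ρ l (x - S (ρ * v) x)‖ ≤ l * (2 * v * ‖x‖) := by gcongr
    _ = _ := by field_simp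

theorem inner_fejer_self (ρ : ℤ) (l : ℕ) (x : H) :
    ⟪x, fejer S ρ l x⟫ = ((l : ℝ) ^ 2)⁻¹ * ‖progSum S ρ l x‖ ^ 2 := by
  rw [hS.fejer_eq_sum_progSum, inner_smul_right, inner_sum, ← real_inner_self_eq_norm_sq]
  have h : ∀ y, ⟪progSum S ρ l x, y⟫ = ∑ k ∈ Finset.Icc 1 l, ⟪S (ρ * k) x, y⟫ := fun y => by
    rw [progSum_apply, sum_inner]
  rw [h]
  congr 1
  refine Finset.sum_congr rfl fun k _ => ?_
  rw [hS.inner_left, mul_neg]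

end IsFlow

/-- A family whose squared norms and off-diagonal inner products are bounded. -/
theorem norm_sum_sq_le_of_inner_le {k : ℕ} {w : ℕ → H} {α β : ℝ} (hβ : 0 ≤ β)
    (hdiag : ∀ i < k, ‖w i‖ ^ 2 ≤ α) (hoff : ∀ i < k, ∀ j < k, i ≠ j → ⟪w i, w j⟫ ≤ β) :
    ‖∑ i ∈ Finset.range k, w i‖ ^ 2 ≤ k * α + k ^ 2 * β := by
  rw [← real_inner_self_eq_norm_sq, sum_inner]
  simp only [inner_sum]
  calc _ ≤ ∑ i ∈ Finset.range k, ∑ j ∈ Finset.range k, ((if i = j then α else 0) + β) := by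
        refine Finset.sum_le_sum fun i hi => Finset.sum_le_sum fun j hj => ?_
        rw [Finset.mem_range] at hi hj
        split_ifs with h
        · subst h
          rw [real_inner_self_eq_norm_sq]
          linarith [hdiag i hi]
        · linarith [hoff i hi j hj h]
    _ = _ := by
        simp only [Finset.sum_add_distrib, Finset.sum_ite_eq, Finset.mem_range, Finset.sum_const,
          Finset.card_range, nsmul_eq_mul, ← Finset.sum_filter]
        rw [Finset.filter_true_of_mem (by simp)]
        simp
        ring

theorem IsFlow.inner_sum_progSum_sub_fejer_le (hS : IsFlow S) {ρ : ℤ} {l k V : ℕ} {τ : ℕ → ℕ}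
    {η B C : ℝ} (hl : 0 < l) (hη0 : 0 ≤ η) (hB : 0 ≤ B) (hC0 : 0 ≤ C)
    (hτ : ∀ i < k, 0 < τ i) (hco : ∀ i < k, ∀ j < k, i ≠ j → Nat.Coprime (τ i) (τ j))
    (hη : ∀ i < k, ∀ j < k, 2 * ((τ i : ℝ) + τ j + (l : ℝ) / τ j) ≤ η * V)
    (hC : 4 * k + 2 * k ^ 2 * η ≤ C ^ 2) {e : ℕ → H} (he : ∀ i < k, ‖e i‖ ≤ B) (a : H) :
    |⟪∑ i ∈ Finset.range k, progSum S (ρ * τ i) V (e i), a - fejer S ρ l a⟫|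
      ≤ V * B * C * ‖a‖ := by
  have h1 : ⟪∑ i ∈ Finset.range k, progSum S (ρ * τ i) V (e i), a - fejer S ρ l a⟫
      = ⟪∑ i ∈ Finset.range k, progSum S (ρ * τ i) V (e i - fejer S ρ l (e i)), a⟫ := by
    simp only [sum_inner, map_sub, inner_sub_left, inner_sub_right, ← hS.fejer_progSum,
      hS.inner_fejer, Finset.sum_sub_distrib]
  have h2 : ‖∑ i ∈ Finset.range k, progSum S (ρ * τ i) V (e i - fejer S ρ l (e i))‖ ^ 2
      ≤ k * (V * (2 * B)) ^ 2 + k ^ 2 * (η * V ^ 2 * (B * (2 * B))) := by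
    refine norm_sum_sq_le_of_inner_le (by positivity) (fun i hi => ?_) fun i hi j hj hij => ?_
    · have h3 := norm_sub_fejer_le (S := S) ρ hl (e i)
      have h4 := norm_progSum_le (S := S) (ρ * τ i) V (e i - fejer S ρ l (e i))
      have h5 := he i hi
      gcongr
      refine h4.trans ?_
      gcongr
      linarith
    · refine (hS.inner_progSum_sub_fejer_le hl (hτ j hj) (hco i hi j hj hij) (hη i hi j hj)
        _ _).trans ?_
      have h3 := norm_sub_fejer_le (S := S) ρ hl (e j)
      have h5 := he i hi
      have h6 := he j hj
      gcongr
      linarith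
  rw [h1]
  refine (abs_real_inner_le_norm _ _).trans ?_
  refine mul_le_mul_of_nonneg_right (abs_le_of_sq_le_sq' ?_ (by positivity)).2 (norm_nonneg _)
  refine h2.trans ?_
  calc _ = (V * B) ^ 2 * (4 * k + 2 * k ^ 2 * η) := by ring
    _ ≤ (V * B) ^ 2 * C ^ 2 := by gcongr
    _ = _ := by ring

theorem sum_norm_sum_sq_le {ι : Type*} (s : Finset ι) (u : ℕ → ι → H) {α β : ℝ} {n : ℕ}
    (hdiag : ∀ k < n, ∑ v ∈ s, ‖u k v‖ ^ 2 ≤ α)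
    (hoff : ∀ k < n, ∑ v ∈ s, ⟪∑ i ∈ Finset.range k, u i v, u k v⟫ ≤ β) :
    ∑ v ∈ s, ‖∑ i ∈ Finset.range n, u i v‖ ^ 2 ≤ n * (α + 2 * β) := by
  induction n with
  | zero => simp
  | succ n ih =>
    have h1 := ih (fun k hk => hdiag k (by omega)) fun k hk => hoff k (by omega)
    have h2 := hdiag n (by omega)
    have h3 := hoff n (by omega)
    simp only [Finset.sum_range_succ, norm_add_sq_real, Finset.sum_add_distrib,
      ← Finset.mul_sum]
    push_cast
    linarith

/-- The data attached to a family of progressions whose pairwise differences behave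
independently of each other. -/
structure IsSpread (ρ : ℕ → ℤ) (τ : ℕ → ℕ → ℕ) (n l V : ℕ) (η : ℝ) : Prop where
  eq : ∀ k < n, ∀ i < k, ρ i = ρ k * (τ i k + 1)
  pos : ∀ k < n, ∀ i < k, 0 < τ i k
  coprime : ∀ k < n, ∀ i < k, ∀ j < k, i ≠ j → Nat.Coprime (τ i k) (τ j k)
  le : ∀ k < n, ∀ i < k, ∀ j < k,
    2 * ((τ i k : ℝ) + τ j k + (l : ℝ) / τ j k) ≤ η * V

/-- The parts of the `a i` of mean zero along a spread family of progressions
are almost orthogonal on average. -/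
theorem IsFlow.sum_norm_sum_shift_sq_le (hS : IsFlow S) {ρ : ℕ → ℤ} {τ : ℕ → ℕ → ℕ}
    {n l V : ℕ} {η A C : ℝ} (hl : 0 < l) (hη0 : 0 ≤ η) (hA : 0 ≤ A) (hC0 : 0 ≤ C)
    (hρ : IsSpread ρ τ n l V η) (hC : 4 * n + 2 * n ^ 2 * η ≤ C ^ 2)
    {a : ℕ → H} (ha : ∀ i < n, ‖a i‖ ≤ A) :
    ∑ v ∈ Finset.Icc 1 V,
        ‖∑ i ∈ Finset.range n, S (ρ i * v) (a i - fejer S (ρ i) l (a i))‖ ^ 2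
      ≤ n * (V * (2 * A) ^ 2 + 2 * (V * (2 * A) * C * A)) := by
  have he : ∀ i < n, ‖a i - fejer S (ρ i) l (a i)‖ ≤ 2 * A := fun i hi =>
    (norm_sub_fejer_le (ρ i) hl (a i)).trans (by linarith [ha i hi])
  refine sum_norm_sum_sq_le _ (fun i (v : ℕ) => S (ρ i * v) (a i - fejer S (ρ i) l (a i)))
    (fun k hk => ?_) fun k hk => ?_
  · refine (Finset.sum_le_sum fun v _ => ?_).trans_eq (b := ∑ v ∈ Finset.Icc 1 V, (2 * A) ^ 2) ?_
    · rw [LinearIsometry.norm_map]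
      exact pow_le_pow_left₀ (norm_nonneg _) (he k hk) 2
    · simp
  · have h1 : ∑ v ∈ Finset.Icc 1 V,
          ⟪∑ i ∈ Finset.range k, S (ρ i * (v : ℤ)) (a i - fejer S (ρ i) l (a i)),
            S (ρ k * (v : ℤ)) (a k - fejer S (ρ k) l (a k))⟫
        = ⟪∑ i ∈ Finset.range k, progSum S (ρ k * τ i k) V (a i - fejer S (ρ i) l (a i)),
            a k - fejer S (ρ k) l (a k)⟫ := by
      simp only [sum_inner, progSum_apply]
      rw [Finset.sum_comm]
      refine Finset.sum_congr rfl fun i hi => Finset.sum_congr rfl fun v _ => ?_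
      rw [← (S (ρ k * (v : ℤ))).inner_map_map (S (ρ k * τ i k * v) _), ← hS.add,
        hρ.eq k hk i (Finset.mem_range.mp hi)]
      congr 3
      ring
    rw [h1]
    refine (le_abs_self _).trans ((hS.inner_sum_progSum_sub_fejer_le hl hη0 (by positivity) hC0
      (hρ.pos k hk) (hρ.coprime k hk) (hρ.le k hk) (le_trans ?_ hC)
      (fun i hi => he i (hi.trans hk)) (a k)).trans ?_)
    · gcongr
    · have := ha k hk
      gcongr

/-- If the `f v` correlate little with the translates of the `a i`, they correlate little with
the Fejér averages of the `a i`. -/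
theorem IsFlow.sum_inner_fejer_le (hS : IsFlow S) {ρ : ℕ → ℤ} {τ : ℕ → ℕ → ℕ}
    {n V q : ℕ} {A : ℝ} (hq : 0 < q) (hV : 0 < V) (hn : n ≤ q ^ 4) (hA : 0 ≤ A)
    (hρ : IsSpread ρ τ n (q * V) V ((q : ℝ) ^ 4)⁻¹)
    {a : ℕ → H} (ha : ∀ i < n, ‖a i‖ ≤ A) {f : ℕ → H} (hf : ∀ v, ‖f v‖ ≤ A)
    (hcorr : ∀ v ∈ Finset.Icc 1 V,
      ∑ i ∈ Finset.range n, ⟪f v, S (ρ i * v) (a i)⟫ ≤ n * (A ^ 2 / q)) :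
    ∑ v ∈ Finset.Icc 1 V, ∑ i ∈ Finset.range n, ⟪f v, fejer S (ρ i) (q * V) (a i)⟫
      ≤ 7 * q ^ 3 * A ^ 2 * V := by
  have hq' : (1 : ℝ) ≤ q := by exact_mod_cast hq
  have hV' : (0 : ℝ) < V := by exact_mod_cast hV
  have hn' : (n : ℝ) ≤ q ^ 4 := by exact_mod_cast hn
  have hl : 0 < q * V := by positivity
  set E : ℕ → H := fun v =>
    ∑ i ∈ Finset.range n, S (ρ i * v) (a i - fejer S (ρ i) (q * V) (a i)) with hE
  have h1 : ∑ v ∈ Finset.Icc 1 V, ‖E v‖ ^ 2 ≤ V * (4 * A * q ^ 3) ^ 2 := by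
    refine (hS.sum_norm_sum_shift_sq_le (C := 5 / 2 * q ^ 2) hl (by positivity) hA
      (by positivity) hρ ?_ ha).trans ?_
    · have : (n : ℝ) ^ 2 * ((q : ℝ) ^ 4)⁻¹ ≤ q ^ 4 := by
        rw [← div_eq_mul_inv, div_le_iff₀ (by positivity), sq]
        gcongr
      nlinarith [pow_pos (zero_lt_one.trans_le hq') 4]
    · have h2 : (q : ℝ) ^ 4 ≤ q ^ 6 := pow_le_pow_right₀ hq' (by norm_num)
      calc _ ≤ (q : ℝ) ^ 4 * (V * (2 * A) ^ 2 + 2 * (V * (2 * A) * (5 / 2 * q ^ 2) * A)) := by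
            gcongr
        _ = V * A ^ 2 * (4 * q ^ 4 + 10 * q ^ 6) := by ring
        _ ≤ V * A ^ 2 * (16 * q ^ 6) := by gcongr; nlinarith [pow_pos (zero_lt_one.trans_le hq') 6]
        _ = _ := by ring
  have h2 : ∑ v ∈ Finset.Icc 1 V, ‖E v‖ ≤ V * (4 * A * q ^ 3) := by
    refine (abs_le_of_sq_le_sq' ?_ (by positivity)).2
    refine (sq_sum_le_card_mul_sum_sq (s := Finset.Icc 1 V) (f := fun v => ‖E v‖)).trans ?_
    rw [Nat.card_Icc, add_tsub_cancel_right, mul_pow, sq (V : ℝ), mul_assoc]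
    gcongr
  have h3 : ∀ v ∈ Finset.Icc 1 V,
      ∑ i ∈ Finset.range n, ⟪f v, fejer S (ρ i) (q * V) (a i)⟫
        ≤ 3 * q ^ 3 * A ^ 2 + A * ‖E v‖ := by
    intro v hv
    have hvV : (v : ℝ) ≤ V := by exact_mod_cast (Finset.mem_Icc.mp hv).2
    have h4 : ∀ i ∈ Finset.range n, ⟪f v, fejer S (ρ i) (q * V) (a i)⟫
        ≤ ⟪f v, S (ρ i * v) (a i)⟫
          - ⟪f v, S (ρ i * v) (a i - fejer S (ρ i) (q * V) (a i))⟫ + 2 * (A ^ 2 / q) := by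
      intro i hi
      have h5 := hS.norm_fejer_sub_shift_le (ρ i) hl v (a i)
      have h6 : 2 * (v : ℝ) / (q * V : ℕ) * ‖a i‖ ≤ 2 / q * A := by
        refine mul_le_mul ?_ (ha i (Finset.mem_range.mp hi)) (norm_nonneg _) (by positivity)
        push_cast
        rw [div_le_div_iff₀ (by positivity) (by positivity)]
        nlinarith
      have h7 := (real_inner_le_norm (f v) (fejer S (ρ i) (q * V) (a i)
        - S (ρ i * v) (fejer S (ρ i) (q * V) (a i)))).trans
        (mul_le_mul (hf v) (h5.trans h6) (norm_nonneg _) hA)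
      rw [inner_sub_right] at h7
      rw [map_sub, inner_sub_right]
      have h8 : A * (2 / q * A) = 2 * (A ^ 2 / q) := by ring
      linarith
    refine (Finset.sum_le_sum h4).trans ?_
    rw [Finset.sum_add_distrib, Finset.sum_sub_distrib, Finset.sum_const,
      Finset.card_range, nsmul_eq_mul]
    have h5 := (abs_le.mp ((abs_real_inner_le_norm (f v) (E v)).trans
      (mul_le_mul_of_nonneg_right (hf v) (norm_nonneg _)))).1
    rw [show ⟪f v, E v⟫ = ∑ i ∈ Finset.range n, _ from inner_sum _ _ _] at h5
    have h6 := hcorr v hv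
    have h7 : n * (A ^ 2 / q) ≤ q ^ 3 * A ^ 2 := by
      calc n * (A ^ 2 / q) ≤ q ^ 4 * (A ^ 2 / q) := by gcongr
        _ = _ := by field_simp
    linarith
  refine (Finset.sum_le_sum h3).trans ?_
  rw [Finset.sum_add_distrib, Finset.sum_const, Nat.card_Icc, nsmul_eq_mul,
    add_tsub_cancel_right, ← Finset.mul_sum]
  nlinarith [mul_le_mul_of_nonneg_left h2 hA]

end Flow

section Cyclic

variable {P : ℕ} [NeZero P]

/-- The translation action of `ℤ` on functions on `ZMod P`. -/
noncomputable def cyclicShift (P : ℕ) [NeZero P] (a : ℤ) :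
    EuclideanSpace ℝ (ZMod P) →ₗᵢ[ℝ] EuclideanSpace ℝ (ZMod P) :=
  (LinearIsometryEquiv.piLpCongrLeft 2 ℝ ℝ (Equiv.subRight (a : ZMod P))).toLinearIsometry

theorem cyclicShift_apply (a : ℤ) (x : EuclideanSpace ℝ (ZMod P)) (m : ZMod P) :
    cyclicShift P a x m = x (m + a) := by
  simp [cyclicShift, LinearIsometryEquiv.piLpCongrLeft_apply]

theorem isFlow_cyclicShift : IsFlow (cyclicShift P) where
  zero x := by ext m; simp [cyclicShift_apply]
  add a b x := by ext m; simp [cyclicShift_apply, add_assoc]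

/-- The indicator function of a set of residues. -/
noncomputable def ind (s : Finset (ZMod P)) : EuclideanSpace ℝ (ZMod P) :=
  WithLp.toLp 2 fun m => if m ∈ s then 1 else 0

theorem inner_ind (s : Finset (ZMod P)) (x : EuclideanSpace ℝ (ZMod P)) :
    ⟪ind s, x⟫ = ∑ m ∈ s, x m := by
  simp [PiLp.inner_apply, ind]

theorem norm_ind_sq (s : Finset (ZMod P)) : ‖ind s‖ ^ 2 = s.card := by
  rw [← real_inner_self_eq_norm_sq, inner_ind]
  simp [ind]

theorem norm_ind_le (s : Finset (ZMod P)) : ‖ind s‖ ≤ √P := by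
  refine Real.le_sqrt_of_sq_le ?_
  rw [norm_ind_sq]
  exact_mod_cast (Finset.card_le_univ s).trans_eq (ZMod.card P)

theorem inner_ind_shift_ind (s t : Finset (ZMod P)) (a : ℤ) :
    ⟪ind s, cyclicShift P a (ind t)⟫ = ((s.filter fun m => m + (a : ZMod P) ∈ t).card : ℝ) := by
  rw [inner_ind]
  simp [cyclicShift_apply, ind]

theorem inner_fejer_ind_mono {s t u : Finset (ZMod P)} (hst : s ⊆ t) (hsu : s ⊆ u) (ρ : ℤ)
    (l : ℕ) :
    ⟪ind s, fejer (cyclicShift P) ρ l (ind s)⟫ ≤ ⟪ind t, fejer (cyclicShift P) ρ l (ind u)⟫ := by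
  simp only [fejer_apply, inner_smul_right, inner_sum, inner_ind_shift_ind]
  gcongr with h _ k _
  intro m hm
  rw [Finset.mem_filter] at hm ⊢
  exact ⟨hst hm.1, hsu hm.2⟩

/-- Every set correlates with its own Fejér average at least as much as a random set does. -/
theorem card_sq_div_le_inner_fejer_ind (s : Finset (ZMod P)) (ρ : ℤ) {l : ℕ} (hl : 0 < l) :
    (s.card : ℝ) ^ 2 / P ≤ ⟪ind s, fejer (cyclicShift P) ρ l (ind s)⟫ := by
  have hl' : (0 : ℝ) < l := by exact_mod_cast hl
  have hP : (0 : ℝ) < P := by exact_mod_cast Nat.pos_of_neZero P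
  have h1 : ⟪ind Finset.univ, progSum (cyclicShift P) ρ l (ind s)⟫ = l * s.card := by
    rw [progSum_apply, inner_sum]
    have : ∀ a, ⟪ind Finset.univ, cyclicShift P a (ind s)⟫ = s.card := fun a => by
      have h : ind (P := P) Finset.univ = cyclicShift P a (ind Finset.univ) := by
        ext m
        simp [cyclicShift_apply, ind]
      rw [h, LinearIsometry.inner_map_map, real_inner_comm, inner_ind]
      simp [ind]
    simp [this]
  have h2 := abs_real_inner_le_norm (ind Finset.univ) (progSum (cyclicShift P) ρ l (ind s))
  have h3 := pow_le_pow_left₀ (abs_nonneg _) h2 2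
  rw [sq_abs, h1, mul_pow, mul_pow, norm_ind_sq, Finset.card_univ, ZMod.card] at h3
  rw [isFlow_cyclicShift.inner_fejer_self, div_le_iff₀ hP, mul_assoc, inv_mul_eq_div,
    le_div_iff₀ (by positivity)]
  linarith

/-- The residues, standing for `1, …, P`, whose multiple by `D` receives colour `x`. -/
def colourClass {r : ℕ} (P : ℕ) [NeZero P] (c : ℕ → Fin r) (D : ℕ) (x : Fin r) :
    Finset (ZMod P) :=
  Finset.univ.filter fun m => c ((m.val + 1) * D) = x

theorem card_filter_colourClass_le {r N Y D E K σ : ℕ} {c : ℕ → Fin r}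
    (hc : ∀ x y : ℕ, y < x → 2 < y → x + y ≤ N → x * y ≤ N → c (x + y) ≠ c (x * y))
    (hE : E = D * K) (hK : K = D * σ) (hK2 : 2 < K) (hKY : K ≤ Y) (hσ : σ ≤ Y)
    (hN : P * E ≤ N) (x : Fin r) :
    ((colourClass P c E x).filter fun m => m + ((σ : ℤ) : ZMod P) ∈ colourClass P c D x).card
      ≤ 2 * Y := by
  have hD : 0 < D := Nat.pos_of_ne_zero (by rintro rfl; omega)
  have key : ((colourClass P c E x).filter
      fun m => m + ((σ : ℤ) : ZMod P) ∈ colourClass P c D x).image ZMod.val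
        ⊆ Finset.range Y ∪ Finset.Ico (P - Y) P := by
    intro j hj
    simp only [Finset.mem_image, Finset.mem_filter, colourClass, Finset.mem_univ,
      true_and] at hj
    obtain ⟨m, ⟨h1, h2⟩, rfl⟩ := hj
    have hm := ZMod.val_lt m
    rw [Finset.mem_union, Finset.mem_range, Finset.mem_Ico]
    by_contra! h
    have h3 : m.val < P - Y := by
      by_contra! h'
      exact absurd (h.2 h') (by omega)
    have h4 : (m + ((σ : ℤ) : ZMod P)).val = m.val + σ := by
      have hσP : ((σ : ℤ) : ZMod P).val = σ := by
        rw [Int.cast_natCast, ZMod.val_natCast_of_lt (by omega)]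
      rw [ZMod.val_add_of_lt (by omega), hσP]
    rw [h4] at h2
    have h5 : (m.val + σ + 1) * D = (m.val + 1) * D + K := by rw [hK]; ring
    have h6 : (m.val + 1) * E = (m.val + 1) * D * K := by rw [hE]; ring
    rw [h5] at h2
    rw [h6] at h1
    refine hc _ _ ?_ hK2 ?_ ?_ (h2.trans h1.symm)
    · exact (hKY.trans_lt (by omega)).trans_le (Nat.le_mul_of_pos_right _ hD)
    · rw [← h5]
      refine le_trans (Nat.mul_le_mul (show m.val + σ + 1 ≤ P by omega) (?_ : D ≤ E)) hN
      rw [hE]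
      exact Nat.le_mul_of_pos_right _ (by omega)
    · rw [← h6]
      exact (Nat.mul_le_mul_right _ (by omega)).trans hN
  rw [← Finset.card_image_of_injective _ (ZMod.val_injective P)]
  refine (Finset.card_le_card key).trans ((Finset.card_union_le _ _).trans ?_)
  rw [Finset.card_range, Nat.card_Ico]
  omega

end Cyclic

/-- The first `n` terms of `D` form a chain for divisibility with large gaps, whose quotients are
divisible by the numbers `(D l / D i) ^ 2 - 1` coming from earlier terms. -/
structure IsDivChain (D : ℕ → ℕ) (q n : ℕ) : Prop where
  pos : ∀ k < n, 0 < D k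
  dvd : ∀ k < n, ∀ i < k, D i ∣ D k
  sep : ∀ k < n, ∀ i < k, 4 * q ^ 3 * D i ≤ D k
  gap_dvd : ∀ k < n, ∀ l < k, ∀ i < l, (D l / D i) ^ 2 - 1 ∣ D k / D l

theorem coprime_sq_sub_one {s t : ℕ} (hs : 0 < s) (ht : 0 < t) (h : s ^ 2 - 1 ∣ t) :
    Nat.Coprime ((s * t) ^ 2 - 1) (t ^ 2 - 1) := by
  have h1 := Nat.gcd_dvd_left ((s * t) ^ 2 - 1) (t ^ 2 - 1)
  have h2 := Nat.gcd_dvd_right ((s * t) ^ 2 - 1) (t ^ 2 - 1)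
  set g := Nat.gcd ((s * t) ^ 2 - 1) (t ^ 2 - 1)
  have hs2 : 1 ≤ s ^ 2 := Nat.one_le_pow _ _ hs
  have ht2 : 1 ≤ t ^ 2 := Nat.one_le_pow _ _ ht
  have h3 : (s * t) ^ 2 - 1 = s ^ 2 * (t ^ 2 - 1) + (s ^ 2 - 1) := by
    have hst : 1 ≤ (s * t) ^ 2 := Nat.one_le_pow _ _ (by positivity)
    zify [hs2, ht2, hst]
    ring
  rw [h3, Nat.dvd_add_right (h2.mul_left _)] at h1
  have h4 : g ∣ t ^ 2 := (h1.trans h).trans (dvd_pow_self t two_ne_zero)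
  have h5 : g ∣ 1 := by
    have := Nat.dvd_sub h4 h2
    rwa [Nat.sub_sub_self ht2] at this
  exact Nat.dvd_one.mp h5

theorem Nat.div_eq_div_mul_div {a b c : ℕ} (hb : 0 < b) (hab : a ∣ b) (hbc : b ∣ c) :
    c / a = b / a * (c / b) := by
  obtain ⟨d, rfl⟩ := hab
  obtain ⟨e, rfl⟩ := hbc
  rw [Nat.mul_div_cancel_left _ hb, mul_assoc, Nat.mul_div_cancel_left _ (by lia),
    Nat.mul_div_cancel_left _ (by lia)]

namespace IsDivChain

variable {D : ℕ → ℕ} {q n : ℕ}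

theorem le_div (hD : IsDivChain D q n) {i k : ℕ} (hk : k < n) (hi : i < k) :
    4 * q ^ 3 ≤ D k / D i :=
  (Nat.le_div_iff_mul_le (hD.pos i (hi.trans hk))).mpr (hD.sep k hk i hi)

theorem coprime (hD : IsDivChain D q n) {i j k : ℕ} (hk : k < n) (hi : i < k) (hj : j < k)
    (hij : i ≠ j) :
    Nat.Coprime ((D k / D i) ^ 2 - 1) ((D k / D j) ^ 2 - 1) := by
  wlog h : i < j generalizing i j
  · exact (this hj hi hij.symm (by omega)).symm
  have hdi := hD.dvd j (hj.trans hk) i h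
  have hdj := hD.dvd k hk j hj
  rw [Nat.div_eq_div_mul_div (hD.pos _ (hj.trans hk)) hdi hdj]
  exact coprime_sq_sub_one
    (Nat.div_pos (Nat.le_of_dvd (hD.pos _ (hj.trans hk)) hdi) (hD.pos _ (hi.trans hk)))
    (Nat.div_pos (Nat.le_of_dvd (hD.pos _ hk) hdj) (hD.pos _ (hj.trans hk)))
    (hD.gap_dvd k hk j hj i h)

/-- The multiplier by which a chain of length `n + 1` is extended. -/
def step (D : ℕ → ℕ) (q n : ℕ) : ℕ :=
  4 * q ^ 3 * ∏ i ∈ Finset.range n, ((D n / D i) ^ 2 - 1)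

theorem extend (hD : IsDivChain D q (n + 1)) (hq : 0 < q) {v : ℕ} (hv : 0 < v) {D' : ℕ → ℕ}
    (h1 : ∀ k < n + 1, D' k = D k) (h2 : D' (n + 1) = D n ^ 2 * (step D q n * v)) :
    IsDivChain D' q (n + 2) ∧ 0 < step D q n := by
  have hDn := hD.pos n (by omega)
  have hstep : 0 < step D q n := by
    refine Nat.mul_pos (by positivity) (Finset.prod_pos fun i hi => ?_)
    have h3 := hD.le_div (Nat.lt_succ_self n) (Finset.mem_range.mp hi)
    have h4 : 1 < D n / D i := lt_of_lt_of_le (by nlinarith [pow_pos hq 3]) h3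
    have := Nat.one_lt_pow two_ne_zero h4
    omega
  have hdvd : ∀ i < n + 1, D i ∣ D n := fun i hi => by
    rcases Nat.lt_succ_iff_lt_or_eq.mp hi with h | rfl
    exacts [hD.dvd n (by omega) i h, dvd_rfl]
  have hle : ∀ i < n + 1, D i ≤ D n := fun i hi => Nat.le_of_dvd hDn (hdvd i hi)
  refine ⟨⟨fun k hk => ?_, fun k hk i hi => ?_, fun k hk i hi => ?_, fun k hk l hl i hi => ?_⟩,
    hstep⟩ <;> rcases Nat.lt_succ_iff_lt_or_eq.mp hk with hk' | rfl
  · rw [h1 k hk']; exact hD.pos k hk'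
  · rw [h2]; positivity
  · rw [h1 k hk', h1 i (by omega)]; exact hD.dvd k hk' i hi
  · rw [h2, h1 i hi]
    exact ((hdvd i hi).trans (dvd_pow_self _ two_ne_zero)).mul_right _
  · rw [h1 k hk', h1 i (by omega)]; exact hD.sep k hk' i hi
  · rw [h2, h1 i hi]
    have h3 : 4 * q ^ 3 ≤ step D q n * v :=
      (Nat.le_of_dvd hstep (Dvd.intro _ rfl)).trans (Nat.le_mul_of_pos_right _ hv)
    have h4 : D i ≤ D n ^ 2 := (hle i hi).trans (Nat.le_self_pow two_ne_zero _)
    calc 4 * q ^ 3 * D i ≤ step D q n * v * D n ^ 2 := Nat.mul_le_mul h3 h4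
      _ = _ := mul_comm _ _
  · rw [h1 k hk', h1 l (by omega), h1 i (by omega)]; exact hD.gap_dvd k hk' l hl i hi
  · rw [h2, h1 l hl, h1 i (by omega)]
    have hl0 : 0 < D l := hD.pos l hl
    rcases Nat.lt_succ_iff_lt_or_eq.mp hl with hl' | rfl
    · have h3 := hD.gap_dvd n (by omega) l hl' i hi
      rw [sq (D n), mul_assoc, Nat.mul_div_right_comm (hdvd l hl)]
      exact h3.mul_right _
    · rw [sq (D l), mul_assoc, Nat.mul_div_cancel_left _ hl0]
      refine Dvd.dvd.mul_left (Dvd.dvd.mul_right ?_ _) _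
      exact (Finset.dvd_prod_of_mem (fun i => (D l / D i) ^ 2 - 1)
        (Finset.mem_range.mpr hi)).mul_left _

theorem isSpread (hD : IsDivChain D q (n + 1)) (hq : 0 < q) (R : ℕ) :
    IsSpread (fun i => ((R * (D n / D i) ^ 2 : ℕ) : ℤ)) (fun i k => (D k / D i) ^ 2 - 1) (n + 1)
      (q * (8 * q ^ 4 * D n ^ 2)) (8 * q ^ 4 * D n ^ 2) ((q : ℝ) ^ 4)⁻¹ := by
  have hdvd : ∀ i < n + 1, D i ∣ D n := fun i hi => by
    rcases Nat.lt_succ_iff_lt_or_eq.mp hi with h | rfl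
    exacts [hD.dvd n (by omega) i h, dvd_rfl]
  have hDn := hD.pos n (by omega)
  have hlow : ∀ k < n + 1, ∀ i < k, 8 * q ^ 5 + 1 ≤ (D k / D i) ^ 2 := fun k hk i hi => by
    have h1 := Nat.pow_le_pow_left (hD.le_div hk hi) 2
    have h2 : q ^ 5 ≤ q ^ 6 := Nat.pow_le_pow_right hq (by norm_num)
    have h3 := pow_pos hq 5
    calc 8 * q ^ 5 + 1 ≤ 16 * q ^ 6 := by omega
      _ = (4 * q ^ 3) ^ 2 := by ring
      _ ≤ _ := h1
  have hup : ∀ k < n + 1, ∀ i < k, (D k / D i) ^ 2 ≤ D n ^ 2 := fun k hk i hi =>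
    Nat.pow_le_pow_left ((Nat.div_le_self _ _).trans (Nat.le_of_dvd hDn (hdvd k hk))) 2
  refine ⟨fun k hk i hi => ?_, fun k hk i hi => ?_, fun k hk i hi j hj => hD.coprime hk hi hj,
    fun k hk i hi j hj => ?_⟩
  · have h1 := hlow k hk i hi
    rw [Nat.div_eq_div_mul_div (hD.pos k hk) (hD.dvd k hk i hi) (hdvd k hk)]
    push_cast [Nat.cast_sub (show 1 ≤ (D k / D i) ^ 2 by omega)]
    ring
  · have := hlow k hk i hi
    have := pow_pos hq 5
    omega
  · have h1 := hlow k hk j hj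
    have h2 : ((8 * q ^ 5 : ℕ) : ℝ) ≤ ((D k / D j) ^ 2 - 1 : ℕ) := by
      exact_mod_cast (show 8 * q ^ 5 ≤ (D k / D j) ^ 2 - 1 by omega)
    have h3 : (((D k / D j) ^ 2 - 1 : ℕ) : ℝ) ≤ (D n : ℝ) ^ 2 := by
      exact_mod_cast (Nat.sub_le _ 1).trans (hup k hk j hj)
    have h4 : (((D k / D i) ^ 2 - 1 : ℕ) : ℝ) ≤ (D n : ℝ) ^ 2 := by
      exact_mod_cast (Nat.sub_le _ 1).trans (hup k hk i hi)
    have hq' : (0 : ℝ) < q := by exact_mod_cast hq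
    have h5 : ((q * (8 * q ^ 4 * D n ^ 2) : ℕ) : ℝ) / ((D k / D j) ^ 2 - 1 : ℕ) ≤ (D n : ℝ) ^ 2 := by
      push_cast at h2 ⊢
      rw [div_le_iff₀ (lt_of_lt_of_le (by positivity) h2)]
      calc (q : ℝ) * (8 * q ^ 4 * D n ^ 2) = D n ^ 2 * (8 * q ^ 5) := by ring
        _ ≤ _ := by gcongr
    have h6 : ((q : ℝ) ^ 4)⁻¹ * (8 * q ^ 4 * D n ^ 2 : ℕ) = 8 * (D n : ℝ) ^ 2 := by
      push_cast
      field_simp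
    rw [h6]
    linarith [sq_nonneg (D n : ℝ)]

end IsDivChain

/-- For a colouring without monochromatic `{x + y, x * y}`, a chain can be extended so that few
residues give its new term the same colour as an earlier term. -/
theorem IsDivChain.exists_extend {r N Y q P n : ℕ} [NeZero P] {c : ℕ → Fin r}
    (hc : ∀ x y : ℕ, y < x → 2 < y → x + y ≤ N → x * y ≤ N → c (x + y) ≠ c (x * y))
    {D : ℕ → ℕ} (hD : IsDivChain D q (n + 1)) (hq : 0 < q) (hP : P = 2 * q * Y)
    (hn : n + 1 ≤ q ^ 4) (hY : D n ^ 2 * (step D q n * (8 * q ^ 4 * D n ^ 2)) ≤ Y)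
    (hN : P * Y ≤ N) :
    ∃ v, 0 < v ∧ v ≤ 8 * q ^ 4 * D n ^ 2 ∧
      ∑ i ∈ Finset.range (n + 1), ∑ x, ((colourClass P c (D i) x
        ∩ colourClass P c (D n ^ 2 * (step D q n * v)) x).card : ℝ) ^ 2
          ≤ 7 * r * q ^ 3 * P ^ 2 := by
  have hDn := hD.pos n (by omega)
  have hq' : (0 : ℝ) < q := by exact_mod_cast hq
  have hP' : (0 : ℝ) < P := by exact_mod_cast Nat.pos_of_neZero P
  have hstep : 0 < step D q n :=
    (hD.extend hq one_pos (D' := Function.update D (n + 1) (D n ^ 2 * (step D q n * 1)))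
      (fun k hk => Function.update_of_ne (by omega) _ _) (Function.update_self _ _ _)).2
  have hstep3 : 2 < step D q n := by
    have h1 : 4 * q ^ 3 ≤ step D q n := Nat.le_of_dvd hstep (Dvd.intro _ rfl)
    have := pow_pos hq 3
    omega
  have hdvd : ∀ i < n + 1, D i ∣ D n := fun i hi => by
    rcases Nat.lt_succ_iff_lt_or_eq.mp hi with h | rfl
    exacts [hD.dvd n (by omega) i h, dvd_rfl]
  set V := 8 * q ^ 4 * D n ^ 2 with hVdef
  have hV : 0 < V := by positivity
  have hV' : (0 : ℝ) < V := by exact_mod_cast hV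
  set E : ℕ → ℕ := fun v => D n ^ 2 * (step D q n * v) with hE
  set ρ : ℕ → ℤ := fun i => ((step D q n * (D n / D i) ^ 2 : ℕ) : ℤ) with hρ
  have hcorr : ∀ x, ∀ v ∈ Finset.Icc 1 V, ∑ i ∈ Finset.range (n + 1),
      ⟪ind (colourClass P c (E v) x), cyclicShift P (ρ i * v) (ind (colourClass P c (D i) x))⟫
        ≤ ((n + 1 : ℕ) : ℝ) * (√P ^ 2 / q) := by
    intro x v hv
    rw [Finset.mem_Icc] at hv
    refine (Finset.sum_le_sum fun i hi => ?_).trans_eq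
      (b := ∑ i ∈ Finset.range (n + 1), √P ^ 2 / q) (by simp)
    rw [Finset.mem_range] at hi
    obtain ⟨t, ht⟩ := hdvd i hi
    have hDi := hD.pos i hi
    have hdiv : D n / D i = t := by rw [ht, Nat.mul_div_cancel_left _ hDi]
    have ht0 : 0 < t := Nat.pos_of_ne_zero (by rintro rfl; omega)
    have hEY : E v ≤ Y := le_trans (by dsimp only [E]; gcongr; exact hv.2) hY
    have hEσ : E v = D i * (D i * (step D q n * t ^ 2 * v)) := by
      dsimp only [E]
      rw [ht]
      ring
    have hKE : D i * (step D q n * t ^ 2 * v) ≤ E v := hEσ ▸ Nat.le_mul_of_pos_left _ hDi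
    have hσK : step D q n * t ^ 2 * v ≤ D i * (step D q n * t ^ 2 * v) :=
      Nat.le_mul_of_pos_left _ hDi
    have hσ2 : 2 < step D q n * t ^ 2 * v := by
      rw [mul_assoc]
      exact hstep3.trans_le (Nat.le_mul_of_pos_right _ (Nat.mul_pos (by positivity) hv.1))
    have h1 := card_filter_colourClass_le (P := P) (Y := Y) hc hEσ rfl (by omega) (by omega)
      (by omega) ((Nat.mul_le_mul_left P hEY).trans hN) x
    rw [inner_ind_shift_ind, Real.sq_sqrt hP'.le,
      show (P : ℝ) / q = (2 * Y : ℕ) by rw [hP]; push_cast; field_simp]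
    have h2 : ρ i * v = ((step D q n * t ^ 2 * v : ℕ) : ℤ) := by
      dsimp only [ρ]
      rw [hdiv]
      push_cast
      ring
    rw [h2]
    exact_mod_cast h1
  have hcol : ∀ x, ∑ v ∈ Finset.Icc 1 V, ∑ i ∈ Finset.range (n + 1),
      ((colourClass P c (D i) x ∩ colourClass P c (E v) x).card : ℝ) ^ 2 / P
        ≤ 7 * q ^ 3 * P * V := by
    intro x
    have h1 := isFlow_cyclicShift.sum_inner_fejer_le hq hV hn (Real.sqrt_nonneg P)
      (hD.isSpread hq (step D q n)) (a := fun i => ind (colourClass P c (D i) x))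
      (fun i _ => norm_ind_le _) (f := fun v => ind (colourClass P c (E v) x))
      (fun v => norm_ind_le _) (hcorr x)
    rw [Real.sq_sqrt hP'.le] at h1
    refine le_trans (Finset.sum_le_sum fun v _ => Finset.sum_le_sum fun i _ => ?_) h1
    exact (card_sq_div_le_inner_fejer_ind _ _ (by positivity)).trans
      (inner_fejer_ind_mono Finset.inter_subset_right Finset.inter_subset_left _ _)
  obtain ⟨v, hv, h⟩ := Finset.exists_le_of_sum_le (s := Finset.Icc 1 V)
    (f := fun v => ∑ i ∈ Finset.range (n + 1), ∑ x,
      ((colourClass P c (D i) x ∩ colourClass P c (E v) x).card : ℝ) ^ 2 / P)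
    (g := fun _ => 7 * r * q ^ 3 * (P : ℝ)) ⟨1, by simp; omega⟩ (by
      calc _ = ∑ x, ∑ v ∈ Finset.Icc 1 V, ∑ i ∈ Finset.range (n + 1),
            ((colourClass P c (D i) x ∩ colourClass P c (E v) x).card : ℝ) ^ 2 / P := by
            rw [eq_comm, Finset.sum_comm]
            refine Finset.sum_congr rfl fun v _ => ?_
            rw [Finset.sum_comm]
        _ ≤ ∑ x : Fin r, 7 * (q : ℝ) ^ 3 * P * V := Finset.sum_le_sum fun x _ => hcol x
        _ = _ := by
            simp
            ring)
  rw [Finset.mem_Icc] at hv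
  refine ⟨v, hv.1, hv.2, ?_⟩
  simp only [← Finset.sum_div] at h
  rw [div_le_iff₀ hP'] at h
  exact h.trans_eq (by ring)

theorem IsDivChain.mul_step_le {D : ℕ → ℕ} {q n e B : ℕ} (hq : 32 ≤ q) (he : 0 < e)
    (hDn : D n ≤ q ^ e) (hB : 2 * n + 16 ≤ B) :
    D n ^ 2 * (step D q n * (8 * q ^ 4 * D n ^ 2)) ≤ q ^ (e * B) := by
  have h1 : ∏ i ∈ Finset.range n, ((D n / D i) ^ 2 - 1) ≤ (D n ^ 2) ^ n := by
    refine (Finset.prod_le_pow_card _ _ (D n ^ 2) fun i _ => ?_).trans_eq (by simp)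
    exact (Nat.sub_le _ _).trans (Nat.pow_le_pow_left (Nat.div_le_self _ _) 2)
  calc D n ^ 2 * (step D q n * (8 * q ^ 4 * D n ^ 2))
      ≤ D n ^ 2 * (4 * q ^ 3 * (D n ^ 2) ^ n * (8 * q ^ 4 * D n ^ 2)) := by
        unfold step
        gcongr
    _ = 32 * q ^ 7 * D n ^ (2 * n + 4) := by rw [← pow_mul]; ring
    _ ≤ q * q ^ 7 * (q ^ e) ^ (2 * n + 4) := by gcongr
    _ = q ^ (8 + e * (2 * n + 4)) := by rw [← pow_mul]; ring
    _ ≤ q ^ (e * B) := by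
        refine Nat.pow_le_pow_right (by omega) ?_
        calc 8 + e * (2 * n + 4) ≤ e * (2 * n + 16) := by nlinarith
          _ ≤ _ := Nat.mul_le_mul_left _ hB

/-- For a colouring without monochromatic `{x + y, x * y}`, there is a long chain whose terms
rarely give a residue the same colour. -/
theorem exists_isDivChain {r N Y q P T : ℕ} [NeZero P] {c : ℕ → Fin r}
    (hc : ∀ x y : ℕ, y < x → 2 < y → x + y ≤ N → x * y ≤ N → c (x + y) ≠ c (x * y))
    (hq : 32 ≤ q) (hT : T ≤ q ^ 4) (hY : Y = q ^ (2 * T + 14) ^ T) (hP : P = 2 * q * Y)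
    (hN : P * Y ≤ N) (n : ℕ) (hn : n + 1 ≤ T) :
    ∃ D : ℕ → ℕ, IsDivChain D q (n + 1) ∧ D n ≤ q ^ (2 * T + 14) ^ n ∧
      ∀ k < n + 1, ∑ i ∈ Finset.range k, ∑ x,
        ((colourClass P c (D i) x ∩ colourClass P c (D k) x).card : ℝ) ^ 2
          ≤ 7 * r * q ^ 3 * P ^ 2 := by
  induction n with
  | zero =>
    refine ⟨fun _ => 1, ⟨fun k _ => one_pos, fun k hk i hi => dvd_rfl, fun k hk i hi => by omega,
      fun k hk l hl i hi => by omega⟩, Nat.one_le_pow _ _ (by omega), fun k hk => ?_⟩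
    obtain rfl : k = 0 := by omega
    rw [Finset.range_zero, Finset.sum_empty]
    positivity
  | succ n ih =>
    obtain ⟨D, hD, hDn, hcard⟩ := ih (by omega)
    have hmul := IsDivChain.mul_step_le hq (by positivity) hDn (B := 2 * T + 14) (by omega)
    rw [← pow_succ] at hmul
    have hmulY := hmul.trans (Nat.pow_le_pow_right (by omega)
      (Nat.pow_le_pow_right (show 0 < 2 * T + 14 by omega) (show n + 1 ≤ T by omega)))
    obtain ⟨v, hv0, hvV, hv⟩ := hD.exists_extend hc (by omega) hP (by omega)
      (hmulY.trans hY.ge) hN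
    set D' := Function.update D (n + 1) (D n ^ 2 * (IsDivChain.step D q n * v)) with hD'
    have h1 : ∀ k < n + 1, D' k = D k := fun k hk => Function.update_of_ne (by omega) _ _
    have h2 : D' (n + 1) = D n ^ 2 * (IsDivChain.step D q n * v) := Function.update_self _ _ _
    refine ⟨D', (hD.extend (by omega) hv0 h1 h2).1, ?_, fun k hk => ?_⟩
    · rw [h2]
      refine le_trans ?_ hmul
      gcongr
    · rcases Nat.lt_succ_iff_lt_or_eq.mp hk with hk' | rfl
      · rw [h1 k hk']
        refine (Finset.sum_congr rfl fun i hi => ?_).trans_le (hcard k hk')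
        rw [h1 i ((Finset.mem_range.mp hi).trans hk')]
      · rw [h2]
        refine (Finset.sum_congr rfl fun i hi => ?_).trans_le hv
        rw [h1 i (Finset.mem_range.mp hi)]

theorem sum_range_sum_range_of_symm {f : ℕ → ℕ → ℝ} (hf : ∀ i j, f i j = f j i) (T : ℕ) :
    ∑ i ∈ Finset.range T, ∑ j ∈ Finset.range T, f i j
      = ∑ i ∈ Finset.range T, f i i
        + 2 * ∑ k ∈ Finset.range T, ∑ i ∈ Finset.range k, f i k := by
  induction T with
  | zero => simp
  | succ T ih =>
    simp only [Finset.sum_range_succ, Finset.sum_add_distrib, hf T]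
    linarith

theorem sum_sum_sum_rotate {α β γ : Type*} (s : Finset α) (t : Finset β) (u : Finset γ)
    (F : α → β → γ → ℝ) :
    ∑ a ∈ s, ∑ b ∈ t, ∑ d ∈ u, F a b d = ∑ b ∈ t, ∑ d ∈ u, ∑ a ∈ s, F a b d := by
  rw [Finset.sum_comm]
  exact Finset.sum_congr rfl fun b _ => Finset.sum_comm

/-- Among `T` colourings of a finite set with `r` colours, many pairs agree on large sets. -/
theorem le_sum_card_inter_sq {M : Type*} [Fintype M] [DecidableEq M] {r T : ℕ} (hr : 0 < r)
    (hT : 4 * r ≤ T) (g : ℕ → M → Fin r) :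
    (Fintype.card M : ℝ) ^ 2 * T ^ 2 / (4 * r ^ 3)
      ≤ ∑ k ∈ Finset.range T, ∑ i ∈ Finset.range k, ∑ x,
        (((Finset.univ.filter fun m => g i m = x) ∩
          Finset.univ.filter fun m => g k m = x).card : ℝ) ^ 2 := by
  set P : ℝ := (Fintype.card M : ℝ) with hP
  have hP0 : 0 ≤ P := Nat.cast_nonneg _
  have hr' : (0 : ℝ) < r := by exact_mod_cast hr
  have hT' : 4 * (r : ℝ) ≤ T := by exact_mod_cast hT
  set s : ℕ → ℕ → Fin r → ℝ := fun i k x => (((Finset.univ.filter fun m => g i m = x) ∩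
    Finset.univ.filter fun m => g k m = x).card : ℝ) with hs
  have hs' : ∀ i k x, s i k x
      = ∑ m, (if g i m = x then (1 : ℝ) else 0) * (if g k m = x then 1 else 0) := by
    intro i k x
    simp only [hs, ← Finset.filter_and, Finset.card_filter, Nat.cast_sum, Nat.cast_ite,
      Nat.cast_one, Nat.cast_zero, ite_and, ite_mul, one_mul, zero_mul]
  set W : ℝ := ∑ k ∈ Finset.range T, ∑ i ∈ Finset.range k, ∑ x, s i k x with hW
  have hWle : P * T ^ 2 ≤ r * (P * T + 2 * W) := by
    have h1 := sum_range_sum_range_of_symm (f := fun i j => ∑ x, s i j x)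
      (fun i j => Finset.sum_congr rfl fun x _ => by simp only [hs, Finset.inter_comm]) T
    have h2 : ∀ i, ∑ x, s i i x = P := by
      intro i
      simp only [hs']
      rw [Finset.sum_comm]
      simp [hP]
    simp only [h2, Finset.sum_const, Finset.card_range, nsmul_eq_mul] at h1
    have h3 : ∑ i ∈ Finset.range T, ∑ j ∈ Finset.range T, ∑ x, s i j x
        = ∑ m, ∑ x, (∑ i ∈ Finset.range T, if g i m = x then (1 : ℝ) else 0) ^ 2 := by
      simp only [hs', sq, Finset.sum_mul_sum, sum_sum_sum_rotate _ (Finset.range T) (Finset.range T)]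
      exact Finset.sum_congr rfl fun i _ => Finset.sum_congr rfl fun j _ => Finset.sum_comm
    have h4 : ∀ m, (T : ℝ) ^ 2
        ≤ r * ∑ x, (∑ i ∈ Finset.range T, if g i m = x then (1 : ℝ) else 0) ^ 2 := by
      intro m
      have h5 := sq_sum_le_card_mul_sum_sq (s := (Finset.univ : Finset (Fin r)))
        (f := fun x => ∑ i ∈ Finset.range T, if g i m = x then (1 : ℝ) else 0)
      rw [Finset.sum_comm] at h5
      simpa using h5
    have h6 := Finset.sum_le_sum fun m (_ : m ∈ (Finset.univ : Finset M)) => h4 m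
    rw [← Finset.mul_sum, ← h3, h1] at h6
    simp only [Finset.sum_const, Finset.card_univ, nsmul_eq_mul] at h6
    linarith
  have hsq : ∀ i k, 2 * P / r ^ 2 * ∑ x, s i k x - P ^ 2 / r ^ 3 ≤ ∑ x, s i k x ^ 2 := by
    intro i k
    have h1 : ∑ x, (2 * P / r ^ 2 * s i k x - (P / r ^ 2) ^ 2) ≤ ∑ x, s i k x ^ 2 :=
      Finset.sum_le_sum fun x _ => by
        have h2 := sq_nonneg (s i k x - P / r ^ 2)
        have h3 : 2 * P / r ^ 2 * s i k x = 2 * s i k x * (P / r ^ 2) := by ring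
        linarith
    rw [Finset.sum_sub_distrib, ← Finset.mul_sum] at h1
    simp only [Finset.sum_const, Finset.card_univ, Fintype.card_fin, nsmul_eq_mul] at h1
    have h2 : (r : ℝ) * (P / r ^ 2) ^ 2 = P ^ 2 / r ^ 3 := by field_simp
    linarith
  have hsum := Finset.sum_le_sum fun k (_ : k ∈ Finset.range T) =>
    Finset.sum_le_sum fun i (_ : i ∈ Finset.range k) => hsq i k
  simp only [Finset.sum_sub_distrib, ← Finset.mul_sum, Finset.sum_const, Finset.card_range,
    nsmul_eq_mul, ← Finset.sum_mul] at hsum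
  have hgauss : (∑ k ∈ Finset.range T, (k : ℝ)) ≤ T ^ 2 / 2 := by
    have := Finset.sum_range_id_mul_two T
    have h2 : (∑ k ∈ Finset.range T, (k : ℝ)) * 2 = ((T * (T - 1) : ℕ) : ℝ) := by
      rw [← this]
      push_cast
      rfl
    have h3 : ((T * (T - 1) : ℕ) : ℝ) ≤ T ^ 2 := by
      rw [sq]
      exact_mod_cast Nat.mul_le_mul_left T (Nat.sub_le T 1)
    linarith
  refine le_trans ?_ hsum
  have h1 : (∑ k ∈ Finset.range T, (k : ℝ)) * (P ^ 2 / r ^ 3) ≤ T ^ 2 / 2 * (P ^ 2 / r ^ 3) := by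
    gcongr
  have h2 : P * T ^ 2 / r - P * T ≤ 2 * W := by
    rw [sub_le_iff_le_add, div_le_iff₀ hr']
    linarith
  have h3 : P / r ^ 2 * (P * T ^ 2 / r - P * T) ≤ P / r ^ 2 * (2 * W) := by gcongr
  have h4 : P ^ 2 * T ^ 2 / (4 * r ^ 3) + T ^ 2 / 2 * (P ^ 2 / r ^ 3)
      ≤ P / r ^ 2 * (P * T ^ 2 / r - P * T) := by
    rw [← sub_nonneg]
    have h5 : P / r ^ 2 * (P * T ^ 2 / r - P * T)
        - (P ^ 2 * T ^ 2 / (4 * r ^ 3) + T ^ 2 / 2 * (P ^ 2 / r ^ 3))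
          = P ^ 2 * T * (T - 4 * r) / (4 * r ^ 3) := by
      field_simp
      ring
    rw [h5]
    have : (0 : ℝ) ≤ T - 4 * r := by linarith
    positivity
  have h6 : 2 * P / r ^ 2 * W = P / r ^ 2 * (2 * W) := by ring
  linarith

theorem chain_bound_le {r N : ℕ} (hr : 32 ≤ r)
    (hN : Real.exp (Real.exp ((r : ℝ) ^ 50)) ≤ N) :
    2 * r ^ 5 * (r ^ 5) ^ (2 * r ^ 20 + 14) ^ r ^ 20
      * (r ^ 5) ^ (2 * r ^ 20 + 14) ^ r ^ 20 ≤ N := by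
  have hr0 : 0 < r := by omega
  have hpow : ∀ x n : ℕ, (x : ℝ) ^ n ≤ Real.exp (x * n : ℕ) := by
    intro x n
    rw [Nat.cast_mul, mul_comm, Real.exp_nat_mul]
    gcongr
    linarith [Real.add_one_le_exp (x : ℝ)]
  set B := 2 * r ^ 20 + 14 with hB
  have hq : 32 ≤ r ^ 5 := hr.trans (Nat.le_self_pow (by norm_num) r)
  set e := B ^ r ^ 20 with he
  have he1 : 1 ≤ e := Nat.one_le_pow _ _ (by omega)
  have hqB : r ^ 5 * 4 ≤ B := by
    have : r ^ 5 * 4 ≤ r ^ 6 := by rw [pow_succ r 5]; gcongr; omega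
    have : r ^ 6 ≤ r ^ 20 := Nat.pow_le_pow_right hr0 (by norm_num)
    omega
  have hB50 : B * (r ^ 20 + 1) ≤ r ^ 50 := by
    have h1 : 14 ≤ r ^ 20 := le_trans (by omega) (Nat.le_self_pow (n := 20) (by norm_num) r)
    calc B * (r ^ 20 + 1) ≤ (3 * r ^ 20) * (2 * r ^ 20) := by gcongr <;> omega
      _ = 6 * r ^ 40 := by ring
      _ ≤ r * r ^ 40 := by gcongr; omega
      _ = r ^ 41 := by ring
      _ ≤ r ^ 50 := Nat.pow_le_pow_right hr0 (by norm_num)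
  have h1 : 2 * r ^ 5 * (r ^ 5) ^ e * (r ^ 5) ^ e ≤ (r ^ 5) ^ (4 * e) := by
    calc 2 * r ^ 5 * (r ^ 5) ^ e * (r ^ 5) ^ e ≤ r ^ 5 * r ^ 5 * (r ^ 5) ^ e * (r ^ 5) ^ e := by
          gcongr; omega
      _ = (r ^ 5) ^ (2 + 2 * e) := by ring
      _ ≤ _ := Nat.pow_le_pow_right (by omega) (by omega)
  have h2 : ((r ^ 5 * (4 * e) : ℕ) : ℝ) ≤ Real.exp ((r : ℝ) ^ 50) := by
    have h3 : r ^ 5 * (4 * e) ≤ B ^ (r ^ 20 + 1) := by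
      rw [pow_succ, ← mul_assoc, mul_comm]
      exact Nat.mul_le_mul_left _ hqB
    calc ((r ^ 5 * (4 * e) : ℕ) : ℝ) ≤ (B : ℝ) ^ (r ^ 20 + 1) := by exact_mod_cast h3
      _ ≤ Real.exp (B * (r ^ 20 + 1) : ℕ) := hpow _ _
      _ ≤ _ := Real.exp_le_exp.mpr (by exact_mod_cast hB50)
  have h3 : (((r ^ 5) ^ (4 * e) : ℕ) : ℝ) ≤ N := by
    rw [Nat.cast_pow]
    exact (hpow _ _).trans ((Real.exp_le_exp.mpr h2).trans hN)
  exact h1.trans (by exact_mod_cast h3)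

/-- There is a constant `r₀` such that for every integer `r ≥ r₀`,
every integer `N ≥ exp (exp (r ^ 50))`, and every `r`-colouring of `{1, …, N}`,
there exist integers `x > y > 2` with `x + y ≤ N`, `x * y ≤ N` and
`x + y` and `x * y` receiving the same colour. -/
theorem monochromatic_sum_product :
    ∃ r₀ : ℕ, ∀ r : ℕ, r₀ ≤ r → ∀ N : ℕ,
      Real.exp (Real.exp ((r : ℝ) ^ 50)) ≤ (N : ℝ) →
      ∀ c : ℕ → Fin r,
        ∃ x y : ℕ, y < x ∧ 2 < y ∧ x + y ≤ N ∧ x * y ≤ N ∧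
          c (x + y) = c (x * y) := by
  refine ⟨32, fun r hr N hN c => ?_⟩
  by_contra! hc
  have hN' := chain_bound_le hr hN
  have hr0 : 0 < r := by omega
  have hq : 32 ≤ r ^ 5 := hr.trans (Nat.le_self_pow (by norm_num) r)
  have hT : 4 * r ≤ r ^ 20 := by
    calc 4 * r ≤ r * r := by gcongr; omega
      _ = r ^ 2 := by ring
      _ ≤ r ^ 20 := Nat.pow_le_pow_right hr0 (by norm_num)
  set Y := (r ^ 5) ^ (2 * r ^ 20 + 14) ^ r ^ 20 with hY
  set P := 2 * r ^ 5 * Y with hP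
  have hP0 : 0 < P := by positivity
  clear_value Y P
  have : NeZero P := ⟨hP0.ne'⟩
  obtain ⟨D, -, -, hD⟩ := exists_isDivChain (T := r ^ 20) hc hq (by rw [← pow_mul]) hY hP hN'
    (r ^ 20 - 1) (by omega)
  have hcount := le_sum_card_inter_sq hr0 hT fun i (m : ZMod P) => c ((m.val + 1) * D i)
  have hle := Finset.sum_le_sum fun k (hk : k ∈ Finset.range (r ^ 20)) =>
    hD k (by rw [Finset.mem_range] at hk; omega)
  have h := hcount.trans hle
  rw [ZMod.card, Finset.sum_const, Finset.card_range, nsmul_eq_mul,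
    div_le_iff₀ (by positivity)] at h
  push_cast at h
  have hPr : (0 : ℝ) < P := by exact_mod_cast hP0
  have hrr : (32 : ℝ) ≤ r := by exact_mod_cast hr
  have h5 : (P : ℝ) ^ 2 * r ^ 39 * r ≤ (P : ℝ) ^ 2 * r ^ 39 * 28 := by
    linarith
  linarith [le_of_mul_le_mul_left h5 (by positivity)]
end

section
/- For every positive integer r, setting N := (3^r + 7)/2, there exists a colouring c : {1,…,N} → {1,…,r} such that there are NO integers x, y with x > y > 2, x+y ≤ N and x·y ≤ N satisfying c(x+y) = c(x·y). (Such a colouring is obtained by giving colour i to the interval [aᵢ, aᵢ₊₁) where aᵢ := (3^i + 9)/2 for i = 0,…,r−1, and any colour to {1,2,3,4}.) -/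
/-- For every positive integer `r`, setting `N := (3 ^ r + 7) / 2`,
there is an `r`-colouring of `{1, …, N}` with no monochromatic pattern
`{x + y, x * y}` with `x > y > 2` and `x + y ≤ N`, `x * y ≤ N`. -/
theorem exists_colouring_no_sum_product (r : ℕ) (hr : 0 < r) :
    ∃ c : ℕ → Fin r, ∀ x y : ℕ, y < x → 2 < y →
      x + y ≤ (3 ^ r + 7) / 2 → x * y ≤ (3 ^ r + 7) / 2 →
      c (x + y) ≠ c (x * y) := by
  refine ⟨fun n => ⟨Nat.log 3 (2 * n - 9) % r, Nat.mod_lt _ hr⟩, fun x y hxy hy _ hp heq => ?_⟩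
  have hmul : 3 * (x + y) ≤ x * y + 9 := by nlinarith
  have hpow : 2 * (x * y) - 9 < 3 ^ r := by
    have : 0 < 3 ^ r := by positivity
    omega
  have hprod : Nat.log 3 (2 * (x * y) - 9) < r := Nat.log_lt_of_lt_pow (by omega) hpow
  have hlt : Nat.log 3 (2 * (x + y) - 9) < Nat.log 3 (2 * (x * y) - 9) := by
    rw [← Nat.succ_le_iff, Nat.succ_eq_add_one, ← Nat.log_mul_base (by norm_num) (by omega)]
    exact Nat.log_mono_right (by omega)
  have hmod := congrArg Fin.val heq
  simp only [Nat.mod_eq_of_lt hprod, Nat.mod_eq_of_lt (hlt.trans hprod)] at hmod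
  exact hlt.ne hmod
end
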